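/- arXiv:1606.04419 — 3 statements merged into one kernel-verified Lean document; each statement's English description precedes it below -/
import Mathlib

section
/- Every finite simple graph G on n vertices with m edges contains an independent set S of vertices with 3·|S| ≥ 2n − m (equivalently, an independent set of size at least (2n − m)/3). -/
/-- Subset version, with edges counted twice; by strong induction on the subset. -/
theorem indep_aux {V : Type*} [DecidableEq V]
    (G : SimpleGraph V) [DecidableRel G.Adj] (A : Finset V) :
    ∃ S ⊆ A, (∀ u ∈ S, ∀ v ∈ S, ¬ G.Adj u v) ∧
      4 * A.card ≤ 6 * S.card + ∑ a ∈ A, (A.filter (G.Adj a)).card := by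
  induction A using Finset.strongInduction with
  | H A ih =>
    rcases A.eq_empty_or_nonempty with rfl | ⟨v, hv⟩
    · exact ⟨∅, by simp⟩
    by_cases hd : 2 ≤ (A.filter (G.Adj v)).card
    · obtain ⟨S, hSA, hS, hc⟩ := ih _ (Finset.erase_ssubset hv)
      refine ⟨S, hSA.trans (Finset.erase_subset _ _), hS, ?_⟩
      have h1 : ∑ a ∈ A.erase v, (A.filter (G.Adj a)).card =
          ∑ a ∈ A.erase v, ((A.erase v).filter (G.Adj a)).card + (A.filter (G.Adj v)).card := by
        have h2 : (A.filter (G.Adj v)).card = ∑ a ∈ A.erase v, if G.Adj v a then 1 else 0 := by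
          rw [← Finset.card_filter]
          congr 1
          ext x
          simp only [Finset.mem_filter, Finset.mem_erase]
          exact ⟨fun h => ⟨⟨h.2.ne', h.1⟩, h.2⟩, fun h => ⟨h.1.2, h.2⟩⟩
        rw [h2, ← Finset.sum_add_distrib]
        refine Finset.sum_congr rfl fun a _ => ?_
        rw [Finset.filter_erase]
        split_ifs with h
        · rw [Finset.card_erase_add_one]
          simp [hv, h.symm]
        · rw [Finset.erase_eq_of_notMem]
          · rfl
          · simp [G.adj_comm a v, h]
      have h3 := Finset.add_sum_erase A (fun a => (A.filter (G.Adj a)).card) hv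
      have h4 := Finset.card_erase_add_one hv
      omega
    · set N := A.filter (G.Adj v) with hN
      have hvN : v ∉ N := by simp [hN]
      have hNA : insert v N ⊆ A := Finset.insert_subset hv (Finset.filter_subset _ _)
      obtain ⟨S, hSA, hS, hc⟩ := ih (A \ insert v N)
        (Finset.sdiff_ssubset hNA (Finset.insert_nonempty _ _))
      have hS' : ∀ u ∈ S, u ∈ A ∧ u ≠ v ∧ ¬ G.Adj v u := by
        intro u hu
        have := hSA hu
        simp only [hN, Finset.mem_sdiff, Finset.mem_insert, Finset.mem_filter] at this
        tauto
      have hvS : v ∉ S := fun h => (hS' v h).2.1 rfl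
      refine ⟨insert v S, ?_, ?_, ?_⟩
      · exact Finset.insert_subset hv fun u hu => (hS' u hu).1
      · intro a ha b hb
        rcases Finset.mem_insert.1 ha with rfl | ha2 <;> rcases Finset.mem_insert.1 hb with rfl | hb2
        · exact G.irrefl
        · exact (hS' b hb2).2.2
        · exact fun h => (hS' a ha2).2.2 h.symm
        · exact hS a ha2 b hb2
      · rw [Finset.card_insert_of_notMem hvS]
        have h1 := Finset.sum_sdiff (f := fun a => (A.filter (G.Adj a)).card) hNA
        rw [Finset.sum_insert hvN] at h1
        have h2 : ∑ a ∈ A \ insert v N, ((A \ insert v N).filter (G.Adj a)).card ≤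
            ∑ a ∈ A \ insert v N, (A.filter (G.Adj a)).card :=
          Finset.sum_le_sum fun a _ => Finset.card_le_card
            (Finset.filter_subset_filter _ Finset.sdiff_subset)
        have h3 : N.card ≤ ∑ a ∈ N, (A.filter (G.Adj a)).card := by
          rw [Finset.card_eq_sum_ones]
          refine Finset.sum_le_sum fun a ha => Finset.card_pos.2 ⟨v, ?_⟩
          simp only [hN, Finset.mem_filter] at ha
          simp [hv, ha.2.symm]
        have h4 := Finset.card_sdiff_add_card_eq_card hNA
        rw [Finset.card_insert_of_notMem hvN] at h4
        rw [← hN] at h1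
        omega


/-- Every finite simple graph `G` on `n` vertices with `m` edges contains an
independent set `S` with `3·|S| ≥ 2n − m`. -/
theorem indep_set_ge_two_n_sub_m {V : Type*} [Fintype V] [DecidableEq V]
    (G : SimpleGraph V) [DecidableRel G.Adj] :
    ∃ S : Finset V, (∀ u ∈ S, ∀ v ∈ S, ¬ G.Adj u v) ∧
      2 * (Fintype.card V : ℤ) - (G.edgeFinset.card : ℤ) ≤ 3 * (S.card : ℤ) := by
  obtain ⟨S, -, hS, hc⟩ := indep_aux G Finset.univ
  refine ⟨S, hS, ?_⟩
  have h := G.sum_degrees_eq_twice_card_edges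
  have h2 : ∑ a, (Finset.univ.filter (G.Adj a)).card = ∑ a, G.degree a := by
    refine Finset.sum_congr rfl fun a _ => ?_
    rw [← G.card_neighborFinset_eq_degree, G.neighborFinset_eq_filter]
  rw [h2, h, Finset.card_univ] at hc
  omega
end

section
/- Every finite simple graph G on n vertices with m edges contains a vertex cover X with 3·|X| ≤ n + m (equivalently, a vertex cover of size at most (n + m)/3). -/
/-- Relative version: all edges live inside the finite set `S`; induction on the number of edges. -/
theorem vertex_cover_aux {V : Type*} [Fintype V] [DecidableEq V] (k : ℕ) :
    ∀ (G : SimpleGraph V) [DecidableRel G.Adj] (S : Finset V),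
      (∀ u v : V, G.Adj u v → u ∈ S) → G.edgeFinset.card ≤ k →
      ∃ X : Finset V, (∀ u v : V, G.Adj u v → u ∈ X ∨ v ∈ X) ∧
        3 * X.card ≤ S.card + G.edgeFinset.card := by
  induction k with
  | zero =>
    intro G _ S hS hk
    refine ⟨∅, ?_, by simp⟩
    intro u v h
    have h1 : s(u, v) ∈ G.edgeFinset := by simpa using h
    have h2 := Finset.card_pos.mpr ⟨_, h1⟩
    omega
  | succ k ih =>
    intro G _ S hS hk
    have hdeg : ∀ x, G.degree x ≤ G.edgeFinset.card := fun x => by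
      rw [← G.card_incidenceFinset_eq_degree x]
      exact Finset.card_le_card (G.incidenceFinset_subset x)
    by_cases h2 : ∃ x, 2 ≤ G.degree x
    · obtain ⟨x, hx⟩ := h2
      have hc := G.card_edgeFinset_deleteIncidenceSet x
      have hd := hdeg x
      obtain ⟨y, hy⟩ := (G.degree_pos_iff_exists_adj x).mp (by omega)
      have hxS := hS x y hy
      obtain ⟨X, hX, hcard⟩ := ih (G.deleteIncidenceSet x) (S.erase x) (by
        intro u v h
        rw [SimpleGraph.deleteIncidenceSet_adj] at h
        exact Finset.mem_erase.mpr ⟨h.2.1, hS u v h.1⟩) (by omega)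
      refine ⟨insert x X, ?_, ?_⟩
      · intro u v h
        have := hX u v
        rw [SimpleGraph.deleteIncidenceSet_adj] at this
        simp only [Finset.mem_insert]
        tauto
      · have h1 := Finset.card_insert_le x X
        have h3 := Finset.card_erase_add_one hxS
        omega
    · push Not at h2
      by_cases he : ∃ x y, G.Adj x y
      · obtain ⟨x, y, hy⟩ := he
        have hc := G.card_edgeFinset_deleteIncidenceSet x
        have hd := hdeg x
        have hp := (G.degree_pos_iff_exists_adj x).mpr ⟨y, hy⟩
        have hxS := hS x y hy
        have hyS : y ∈ S.erase x := Finset.mem_erase.mpr ⟨hy.ne', hS y x hy.symm⟩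
        have hyu : ∀ z, G.Adj y z → z = x := by
          intro z hz
          have h1 : (G.neighborFinset y).card ≤ 1 := by
            have := h2 y
            rw [G.card_neighborFinset_eq_degree]
            omega
          exact Finset.card_le_one.mp h1 z (by simpa using hz) x (by simpa using hy.symm)
        obtain ⟨X, hX, hcard⟩ := ih (G.deleteIncidenceSet x) ((S.erase x).erase y) (by
          intro u v h
          rw [SimpleGraph.deleteIncidenceSet_adj] at h
          refine Finset.mem_erase.mpr ⟨?_, Finset.mem_erase.mpr ⟨h.2.1, hS u v h.1⟩⟩
          rintro rfl
          exact h.2.2 (hyu v h.1)) (by omega)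
        refine ⟨insert x X, ?_, ?_⟩
        · intro u v h
          have := hX u v
          rw [SimpleGraph.deleteIncidenceSet_adj] at this
          simp only [Finset.mem_insert]
          tauto
        · have h1 := Finset.card_insert_le x X
          have h3 := Finset.card_erase_add_one hxS
          have h4 := Finset.card_erase_add_one hyS
          omega
      · exact ⟨∅, fun u v h => (he ⟨u, v, h⟩).elim, by simp⟩

/-- Every finite simple graph `G` on `n` vertices with `m` edges contains a
vertex cover `X` with `3·|X| ≤ n + m`. -/
theorem vertex_cover_le_n_add_m_div_three {V : Type*} [Fintype V] [DecidableEq V]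
    (G : SimpleGraph V) [DecidableRel G.Adj] :
    ∃ X : Finset V, (∀ u v : V, G.Adj u v → u ∈ X ∨ v ∈ X) ∧
      3 * X.card ≤ Fintype.card V + G.edgeFinset.card := by
  exact vertex_cover_aux _ G Finset.univ (fun _ _ _ => Finset.mem_univ _) le_rfl
end

section
/- Let G be a finite digraph on n vertices, and suppose there is a set A of arcs of G, with |A| = a, such that the digraph G − A obtained from G by deleting the arcs in A is acyclic. Then G has a feedback vertex set X with 3·|X| ≤ n + a (equivalently, of size at most (n + a)/3). -/
/-- A digraph, given by an arc relation `Arc : V → V → Prop`, is acyclic if it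
contains no directed cycle, i.e. no sequence of `k ≥ 1` distinct vertices
`c 0, c 1, …, c (k-1)` with an arc from each `c i` to `c (i+1)` (indices mod `k`). -/
def DigraphAcyclic {V : Type*} (Arc : V → V → Prop) : Prop :=
  ∀ (k : ℕ), 1 ≤ k → ∀ c : Fin k → V,
    ¬ (Function.Injective c ∧ ∀ i : Fin k, Arc (c i) (c (finRotate k i)))

theorem cover_aux {V : Type*} [DecidableEq V] (n : ℕ) : ∀ (S : Finset V) (A : Finset (V × V)),
    A.card ≤ n → (∀ p ∈ A, p.1 ∈ S ∧ p.2 ∈ S ∧ p.1 ≠ p.2) →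
    ∃ X : Finset V, (∀ p ∈ A, p.1 ∈ X ∨ p.2 ∈ X) ∧ 3 * X.card ≤ S.card + A.card := by
  induction n with
  | zero =>
    intro S A hA h
    have : A = ∅ := by simpa using hA
    subst this
    exact ⟨∅, by simp, by simp⟩
  | succ n ih =>
    intro S A hA h
    by_cases hdeg : ∃ v ∈ S, 2 ≤ (A.filter (fun p => p.1 = v ∨ p.2 = v)).card
    · obtain ⟨v, hv, h2⟩ := hdeg
      have hc := Finset.card_filter_add_card_filter_not (s := A) (fun p => p.1 = v ∨ p.2 = v)
      obtain ⟨X, hX, hXc⟩ := ih (S.erase v) (A.filter (fun p => ¬ (p.1 = v ∨ p.2 = v)))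
        (by omega) (by
          intro p hp
          simp only [Finset.mem_filter, not_or] at hp
          have := h p hp.1
          simp [hp, this])
      refine ⟨insert v X, ?_, ?_⟩
      · intro p hp
        by_cases hpv : p.1 = v ∨ p.2 = v
        · rcases hpv with h | h <;> simp [h]
        · rcases hX p (Finset.mem_filter.2 ⟨hp, hpv⟩) with h | h <;> simp [h]
      · have h1 := Finset.card_insert_le v X
        have h3 := Finset.card_erase_add_one hv
        omega
    · push Not at hdeg
      rcases A.eq_empty_or_nonempty with rfl | ⟨q, hq⟩
      · exact ⟨∅, by simp, by simp⟩
      · obtain ⟨hq1, hq2, hne⟩ := h q hq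
        have key : ∀ v ∈ S, (q.1 = v ∨ q.2 = v) → ∀ p ∈ A, (p.1 = v ∨ p.2 = v) → p = q := by
          intro v hv hqv p hp hpv
          exact Finset.card_le_one.1 (Nat.le_of_lt_succ (hdeg v hv)) p
            (Finset.mem_filter.2 ⟨hp, hpv⟩) q (Finset.mem_filter.2 ⟨hq, hqv⟩)
        have hcA := Finset.card_erase_add_one hq
        obtain ⟨X, hX, hXc⟩ := ih ((S.erase q.1).erase q.2) (A.erase q)
          (by omega) (by
            intro p hp
            obtain ⟨hpq, hpA⟩ := Finset.mem_erase.1 hp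
            obtain ⟨a, b, c⟩ := h p hpA
            have k1 : ¬ (p.1 = q.1 ∨ p.2 = q.1) := fun hh => hpq (key q.1 hq1 (Or.inl rfl) p hpA hh)
            have k2 : ¬ (p.1 = q.2 ∨ p.2 = q.2) := fun hh => hpq (key q.2 hq2 (Or.inr rfl) p hpA hh)
            simp only [not_or] at k1 k2
            simp only [Finset.mem_erase]
            tauto)
        refine ⟨insert q.1 X, ?_, ?_⟩
        · intro p hp
          by_cases hpq : p = q
          · simp [hpq]
          · rcases hX p (Finset.mem_erase.2 ⟨hpq, hp⟩) with h | h <;> simp [h]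
        · have h1 := Finset.card_insert_le q.1 X
          have h3 := Finset.card_erase_add_one hq1
          have h4 := Finset.card_erase_add_one (Finset.mem_erase.2 ⟨hne.symm, hq2⟩)
          omega

/-- Let `G` be a finite digraph on `n` vertices, and `A` a set of `a` arcs of `G`
such that `G − A` is acyclic. Then `G` has a feedback vertex set `X` with
`3·|X| ≤ n + a`. -/
theorem feedback_vertex_set_le_n_add_a_div_three {V : Type*} [Fintype V] [DecidableEq V]
    (Arc : V → V → Prop) (hirr : ∀ v : V, ¬ Arc v v)
    (A : Finset (V × V)) (hAarc : ∀ p ∈ A, Arc p.1 p.2)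
    (hacyc : DigraphAcyclic (fun u v => Arc u v ∧ (u, v) ∉ A)) :
    ∃ X : Finset V,
      DigraphAcyclic (fun u v => Arc u v ∧ u ∉ X ∧ v ∉ X) ∧
      3 * X.card ≤ Fintype.card V + A.card := by
  obtain ⟨X, hX, hc⟩ := cover_aux A.card Finset.univ A le_rfl (by
    intro p hp
    refine ⟨Finset.mem_univ _, Finset.mem_univ _, fun he => ?_⟩
    have := hAarc p hp
    rw [he] at this
    exact hirr _ this)
  refine ⟨X, ?_, by simpa using hc⟩
  rintro k hk c ⟨hinj, harc⟩
  refine hacyc k hk c ⟨hinj, fun i => ⟨(harc i).1, fun hm => ?_⟩⟩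
  rcases hX _ hm with h | h
  · exact (harc i).2.1 h
  · exact (harc i).2.2 h
end
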